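/- (Algebraic skeleton of Theorem 4.7(3).) Let H be a finite-dimensional commutative unital ℚ-algebra, let ∗ be a δ-deformation of the product of H on A for some δ > 0, and let x_1, …, x_M ∈ H generate H as a ℚ-algebra. Let φ̂ : ℚ[X_1,…,X_M] → H and Φ̂ : Λ^univ[X_1,…,X_M] → (A, ∗) be the algebra homomorphisms sending each X_i to x_i. Suppose w_1, …, w_m ∈ ℚ[X_1,…,X_M] generate the ideal ker φ̂, and v_1, …, v_m ∈ ker Φ̂ satisfy 𝔳_T(w_i − v_i) > 0 for all i. Then Φ̂ induces an isomorphism of Λ^univ-algebras Λ^univ[X_1,…,X_M] / Clos_{𝔳_T}(⟨v_1, …, v_m⟩) ≅ (A, ∗). -/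

import Mathlib

/-- The Novikov finiteness condition for an `R`-valued series `f : ℝ → R`
(thought of as `∑ₖ f k · Tᵏ`): for every `c ∈ ℝ`, only finitely many exponents
`k < c` carry a nonzero coefficient.  For `R = ℚ` this carves out `Λ^univ`;
for `R = H` it carves out the module `A` of `H`-valued Novikov series. -/
def NovCondG {R : Type*} [Zero R] (f : ℝ → R) : Prop :=
  ∀ c : ℝ, {k : ℝ | k < c ∧ f k ≠ 0}.Finite

open Classical in
/-- The valuation `𝔳_T`, with `𝔳_T 0 = ∞`: the minimum of the support of a nonzero
series, viewed in `EReal`. -/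
noncomputable def novValE {R : Type*} [Zero R] (f : ℝ → R) : EReal :=
  if f = 0 then ⊤ else ((sInf {k : ℝ | f k ≠ 0} : ℝ) : EReal)

/-- The series `x · T^0` concentrated at exponent `0`; this embeds `R` into the
`R`-valued Novikov series. -/
noncomputable def constSer {R : Type*} [Zero R] (x : R) : ℝ → R :=
  fun k => if k = 0 then x else 0

/-- The `Λ^univ`-scalar action on `H`-valued series, by convolution. -/
noncomputable def convQ {H : Type*} [AddCommMonoid H] [Module ℚ H]
    (f : ℝ → ℚ) (α : ℝ → H) : ℝ → H :=
  fun k => ∑ᶠ a : ℝ, f a • α (k - a)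

/-- Iterated `∗`-power of a series, with respect to a given product `st`. -/
noncomputable def starPow {H : Type*} [CommRing H]
    (st : (ℝ → H) → (ℝ → H) → (ℝ → H)) (α : ℝ → H) : ℕ → (ℝ → H)
  | 0 => constSer 1
  | n + 1 => st α (starPow st α n)

/-- `∗`-evaluation of a monomial `mo` at the elements `x i ∈ H ⊆ A`. -/
noncomputable def monEval {H : Type*} [CommRing H] {M : ℕ}
    (st : (ℝ → H) → (ℝ → H) → (ℝ → H)) (x : Fin M → H) (mo : Fin M →₀ ℕ) : ℝ → H :=
  (List.finRange M).foldr
    (fun i acc => st (starPow st (constSer (x i)) (mo i)) acc) (constSer 1)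

/-- An element of `Λ^univ[X_1,…,X_M]`, encoded as a Novikov series with coefficients
in `ℚ[X_1,…,X_M]`: it satisfies the Novikov support condition and involves only
finitely many monomials in total. -/
def IsPolyNov {M : ℕ} (p : ℝ → MvPolynomial (Fin M) ℚ) : Prop :=
  NovCondG p ∧ (⋃ k : ℝ, ((p k).support : Set (Fin M →₀ ℕ))).Finite

/-- The evaluation homomorphism `Φ̂ : Λ^univ[X_1,…,X_M] → (A, ∗)` sending `X_i` to
`x i`, defined by `Λ^univ`-linear extension of `∗`-evaluation of monomials. -/
noncomputable def polyEval {H : Type*} [CommRing H] [Algebra ℚ H] {M : ℕ}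
    (st : (ℝ → H) → (ℝ → H) → (ℝ → H)) (x : Fin M → H)
    (p : ℝ → MvPolynomial (Fin M) ℚ) : ℝ → H :=
  fun k => ∑ᶠ a : ℝ,
    ∑ mo ∈ (p a).support, MvPolynomial.coeff mo (p a) • monEval st x mo (k - a)

/-- Multiplication in the polynomial ring `Λ^univ[X_1,…,X_M]` (convolution in the
`T`-variable, polynomial multiplication of the coefficients). -/
noncomputable def polyMul {M : ℕ} (p q : ℝ → MvPolynomial (Fin M) ℚ) :
    ℝ → MvPolynomial (Fin M) ℚ :=
  fun k => ∑ᶠ a : ℝ, p a * q (k - a)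

/-- The embedding `ℚ[X_1,…,X_M] → Λ^univ[X_1,…,X_M]`. -/
noncomputable def embedPoly {M : ℕ} (w : MvPolynomial (Fin M) ℚ) :
    ℝ → MvPolynomial (Fin M) ℚ :=
  constSer w

/-- Membership in the ideal of `Λ^univ[X_1,…,X_M]` generated by `v 1, …, v m`. -/
def InIdealGen {M m : ℕ} (v : Fin m → ℝ → MvPolynomial (Fin M) ℚ)
    (p : ℝ → MvPolynomial (Fin M) ℚ) : Prop :=
  ∃ q : Fin m → ℝ → MvPolynomial (Fin M) ℚ,
    (∀ i, IsPolyNov (q i)) ∧ p = ∑ i, polyMul (q i) (v i)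

/-- Membership in `Clos_{𝔳_T}(⟨v 1, …, v m⟩)`, the closure of the ideal generated by
the `v i`: for every `c` there is an ideal element `j` with `p = j` or
`𝔳_T (p - j) ≥ c`. -/
def CloMem {M m : ℕ} (v : Fin m → ℝ → MvPolynomial (Fin M) ℚ)
    (p : ℝ → MvPolynomial (Fin M) ℚ) : Prop :=
  ∀ c : ℝ, ∃ j : ℝ → MvPolynomial (Fin M) ℚ,
    InIdealGen v j ∧ (p = j ∨ (c : EReal) ≤ novValE (p - j))

/-- `st` is a `δ`-deformation of the product of the `ℚ`-algebra `H` on the module `A`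
of `H`-valued Novikov series: a `Λ^univ`-bilinear, associative, commutative product
with unit `1_H` such that `𝔳_T (x ∗ y - x·y) ≥ δ` for all nonzero `x, y ∈ H`. -/
def IsDeltaDeformation {H : Type*} [CommRing H] [Algebra ℚ H]
    (δ : ℝ) (st : (ℝ → H) → (ℝ → H) → (ℝ → H)) : Prop :=
  (∀ α β : ℝ → H, NovCondG α → NovCondG β → NovCondG (st α β)) ∧
  (∀ α β : ℝ → H, NovCondG α → NovCondG β → st α β = st β α) ∧
  (∀ α β γ : ℝ → H, NovCondG α → NovCondG β → NovCondG γ →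
    st (st α β) γ = st α (st β γ)) ∧
  (∀ α β γ : ℝ → H, NovCondG α → NovCondG β → NovCondG γ →
    st (α + β) γ = st α γ + st β γ) ∧
  (∀ (f : ℝ → ℚ) (α β : ℝ → H), NovCondG f → NovCondG α → NovCondG β →
    st (convQ f α) β = convQ f (st α β)) ∧
  (∀ α : ℝ → H, NovCondG α → st (constSer 1) α = α) ∧
  (∀ x y : H, x ≠ 0 → y ≠ 0 →
    (δ : EReal) ≤ novValE (st (constSer x) (constSer y) - constSer (x * y)))


open Filter Topology

/-! ### Series vanishing below a given exponent -/

/-- `f` has no terms of exponent less than `c`, that is, `𝔳_T f ≥ c`. -/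
def VanishesBelow {R : Type*} [Zero R] (c : ℝ) (f : ℝ → R) : Prop :=
  ∀ k, k < c → f k = 0

namespace VanishesBelow

lemma mono {R : Type*} [Zero R] {f : ℝ → R} {c d : ℝ} (h : VanishesBelow c f) (hd : d ≤ c) :
    VanishesBelow d f := fun k hk => h k (hk.trans_le hd)

lemma add {R : Type*} [AddCommGroup R] {f g : ℝ → R} {c : ℝ} (hf : VanishesBelow c f)
    (hg : VanishesBelow c g) : VanishesBelow c (f + g) := fun k hk => by
  simp [hf k hk, hg k hk]

lemma sub {R : Type*} [AddCommGroup R] {f g : ℝ → R} {c : ℝ} (hf : VanishesBelow c f)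
    (hg : VanishesBelow c g) : VanishesBelow c (f - g) := fun k hk => by
  simp [hf k hk, hg k hk]

lemma sum {R ι : Type*} [AddCommGroup R] {f : ι → ℝ → R} {c : ℝ} {s : Finset ι}
    (hf : ∀ i ∈ s, VanishesBelow c (f i)) : VanishesBelow c (∑ i ∈ s, f i) := fun k hk => by
  rw [Finset.sum_apply]
  exact Finset.sum_eq_zero fun i hi => hf i hi k hk

lemma constSer {R : Type*} [Zero R] (x : R) : VanishesBelow 0 (constSer x) := fun k hk => by
  simp [_root_.constSer, hk.ne]

lemma map {R S : Type*} [Zero R] [Zero S] {f : ℝ → R} {c : ℝ} (hf : VanishesBelow c f)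
    (φ : R → S) (hφ : φ 0 = 0) : VanishesBelow c (fun k => φ (f k)) := fun k hk => by
  simp only [hf k hk, hφ]

lemma le_novValE {R : Type*} [Zero R] {f : ℝ → R} {c : ℝ} (h : VanishesBelow c f) :
    (c : EReal) ≤ novValE f := by
  unfold novValE
  split_ifs with h0
  · exact le_top
  · obtain ⟨k, hk⟩ := Function.ne_iff.1 h0
    refine EReal.coe_le_coe_iff.2 (le_csInf ⟨k, hk⟩ fun b hb => ?_)
    by_contra! hlt
    exact hb (h b hlt)

lemma eq_zero {R : Type*} [Zero R] {f : ℝ → R} (h : ∀ c : ℝ, VanishesBelow c f) : f = 0 :=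
  funext fun k => h (k + 1) k (lt_add_one k)

end VanishesBelow

/-! ### Novikov series -/

namespace NovCondG

lemma exists_vanishesBelow {R : Type*} [Zero R] {f : ℝ → R} (hf : NovCondG f) :
    ∃ c, VanishesBelow c f := by
  obtain ⟨b, hb⟩ := (hf 0).bddBelow
  refine ⟨min b 0, fun k hk => ?_⟩
  by_contra h
  exact absurd (hb ⟨hk.trans_le (min_le_right _ _), h⟩) (not_le.2 (hk.trans_le (min_le_left _ _)))

lemma bddBelow_support {R : Type*} [Zero R] {f : ℝ → R} (hf : NovCondG f) :
    BddBelow {k : ℝ | f k ≠ 0} := by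
  obtain ⟨c, hc⟩ := hf.exists_vanishesBelow
  exact ⟨c, fun k hk => not_lt.1 fun h => hk (hc k h)⟩

lemma vanishesBelow_of_le {R : Type*} [Zero R] {f : ℝ → R} (hf : NovCondG f) {c : ℝ}
    (h : (c : EReal) ≤ novValE f) : VanishesBelow c f := by
  intro k hk
  by_contra hne
  have h0 : f ≠ 0 := fun h0 => hne (by simp [h0])
  rw [novValE, if_neg h0, EReal.coe_le_coe_iff] at h
  exact absurd (h.trans (csInf_le hf.bddBelow_support hne)) (not_le.2 hk)

lemma exists_pos_vanishesBelow {R : Type*} [Zero R] {f : ℝ → R} (hf : NovCondG f)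
    (h : 0 < novValE f) : ∃ ε > 0, VanishesBelow ε f := by
  by_cases h0 : f = 0
  · exact ⟨1, one_pos, fun k _ => by simp [h0]⟩
  · have h' := h
    rw [novValE, if_neg h0] at h'
    refine ⟨sInf {k : ℝ | f k ≠ 0}, by exact_mod_cast h', hf.vanishesBelow_of_le ?_⟩
    rw [novValE, if_neg h0]

lemma zero {R : Type*} [Zero R] : NovCondG (0 : ℝ → R) := fun c => by simp

lemma add {R : Type*} [AddCommGroup R] {f g : ℝ → R} (hf : NovCondG f) (hg : NovCondG g) :
    NovCondG (f + g) := fun c => by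
  refine ((hf c).union (hg c)).subset ?_
  rintro k ⟨hk, h⟩
  by_cases h0 : f k = 0
  · exact Or.inr ⟨hk, fun h1 => h (by simp [h0, h1])⟩
  · exact Or.inl ⟨hk, h0⟩

lemma map {R S : Type*} [Zero R] [Zero S] {f : ℝ → R} (hf : NovCondG f) (φ : R → S)
    (hφ : φ 0 = 0) : NovCondG (fun k => φ (f k)) := fun c =>
  (hf c).subset fun k ⟨hk, h⟩ => ⟨hk, fun h0 => h (by simp only [h0, hφ])⟩

lemma neg {R : Type*} [AddCommGroup R] {f : ℝ → R} (hf : NovCondG f) : NovCondG (-f) :=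
  hf.map (fun r => -r) neg_zero

lemma sub {R : Type*} [AddCommGroup R] {f g : ℝ → R} (hf : NovCondG f) (hg : NovCondG g) :
    NovCondG (f - g) := sub_eq_add_neg f g ▸ hf.add hg.neg

lemma sum {R ι : Type*} [AddCommGroup R] {f : ι → ℝ → R} {s : Finset ι}
    (hf : ∀ i ∈ s, NovCondG (f i)) : NovCondG (∑ i ∈ s, f i) :=
  Finset.sum_induction f NovCondG (fun _ _ => add) zero hf

lemma constSer {R : Type*} [Zero R] (x : R) : NovCondG (constSer x) := fun c =>
  (Set.finite_singleton 0).subset fun k ⟨_, h⟩ => by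
    by_contra h0
    exact h (if_neg h0)

end NovCondG

/-! ### Convolution along a biadditive map -/

/-- Convolution of series along a biadditive map of coefficients. -/
noncomputable def novConv {R S T : Type*} [AddCommGroup R] [AddCommGroup S] [AddCommGroup T]
    (B : R →+ S →+ T) (f : ℝ → R) (g : ℝ → S) : ℝ → T :=
  fun k => ∑ᶠ a : ℝ, B (f a) (g (k - a))

section Conv

variable {R S T : Type*} [AddCommGroup R] [AddCommGroup S] [AddCommGroup T] (B : R →+ S →+ T)

lemma novConv_finite_support {f : ℝ → R} {g : ℝ → S} (hf : NovCondG f) (hg : NovCondG g)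
    (k : ℝ) : (Function.support fun a => B (f a) (g (k - a))).Finite := by
  obtain ⟨c, hc⟩ := hg.exists_vanishesBelow
  refine (hf (k - c + 1)).subset fun a ha => ⟨?_, fun h => ha (by simp [h])⟩
  by_contra! h
  exact ha (by simp [hc (k - a) (by linarith)])

lemma NovCondG.novConv {f : ℝ → R} {g : ℝ → S} (hf : NovCondG f) (hg : NovCondG g) :
    NovCondG (novConv B f g) := by
  obtain ⟨c, hc⟩ := hf.exists_vanishesBelow
  obtain ⟨d, hd⟩ := hg.exists_vanishesBelow
  intro e
  refine ((hf (e - d)).image2 (· + ·) (hg (e - c))).subset ?_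
  rintro k ⟨hk, h⟩
  obtain ⟨a, ha⟩ : ∃ a, B (f a) (g (k - a)) ≠ 0 := by
    by_contra! h0
    exact h (by simp [_root_.novConv, h0])
  have hfa : f a ≠ 0 := fun h => ha (by simp [h])
  have hga : g (k - a) ≠ 0 := fun h => ha (by simp [h])
  have h1 : c ≤ a := not_lt.1 fun h => hfa (hc a h)
  have h2 : d ≤ k - a := not_lt.1 fun h => hga (hd _ h)
  exact ⟨a, ⟨by linarith, hfa⟩, k - a, ⟨by linarith, hga⟩, by simp⟩

lemma VanishesBelow.novConv {f : ℝ → R} {g : ℝ → S} {c d : ℝ} (hf : VanishesBelow c f)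
    (hg : VanishesBelow d g) : VanishesBelow (c + d) (novConv B f g) := fun k hk => by
  refine finsum_eq_zero_of_forall_eq_zero fun a => ?_
  rcases lt_or_ge a c with h | h
  · simp [hf a h]
  · simp [hg (k - a) (by linarith)]

lemma novConv_add_left {f f' : ℝ → R} {g : ℝ → S} (hf : NovCondG f) (hf' : NovCondG f')
    (hg : NovCondG g) : novConv B (f + f') g = novConv B f g + novConv B f' g := by
  ext k
  simp only [novConv, Pi.add_apply, map_add, AddMonoidHom.add_apply]
  exact finsum_add_distrib (novConv_finite_support B hf hg k) (novConv_finite_support B hf' hg k)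

lemma novConv_add_right {f : ℝ → R} {g g' : ℝ → S} (hf : NovCondG f) (hg : NovCondG g)
    (hg' : NovCondG g') : novConv B f (g + g') = novConv B f g + novConv B f g' := by
  ext k
  simp only [novConv, Pi.add_apply, map_add]
  exact finsum_add_distrib (novConv_finite_support B hf hg k) (novConv_finite_support B hf hg' k)

lemma novConv_sub_right {f : ℝ → R} {g g' : ℝ → S} (hf : NovCondG f) (hg : NovCondG g)
    (hg' : NovCondG g') : novConv B f (g - g') = novConv B f g - novConv B f g' := by
  rw [eq_sub_iff_add_eq, ← novConv_add_right B hf (hg.sub hg') hg', sub_add_cancel]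

@[simp]
lemma novConv_zero_left (g : ℝ → S) : novConv B 0 g = 0 := by
  ext k
  simp [novConv]

@[simp]
lemma novConv_zero_right (f : ℝ → R) : novConv B f 0 = 0 := by
  ext k
  simp [novConv]

lemma novConv_sum_left {ι : Type*} (s : Finset ι) {f : ι → ℝ → R} {g : ℝ → S}
    (hf : ∀ i ∈ s, NovCondG (f i)) (hg : NovCondG g) :
    novConv B (∑ i ∈ s, f i) g = ∑ i ∈ s, novConv B (f i) g := by
  classical
  induction s using Finset.induction_on with
  | empty => simp
  | insert i s hi ih =>
    simp only [Finset.forall_mem_insert] at hf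
    rw [Finset.sum_insert hi, Finset.sum_insert hi, novConv_add_left B hf.1 (.sum hf.2) hg,
      ih hf.2]

lemma novConv_sum_right {ι : Type*} (s : Finset ι) {f : ℝ → R} {g : ι → ℝ → S}
    (hf : NovCondG f) (hg : ∀ i ∈ s, NovCondG (g i)) :
    novConv B f (∑ i ∈ s, g i) = ∑ i ∈ s, novConv B f (g i) := by
  classical
  induction s using Finset.induction_on with
  | empty => simp
  | insert i s hi ih =>
    simp only [Finset.forall_mem_insert] at hg
    rw [Finset.sum_insert hi, Finset.sum_insert hi, novConv_add_right B hf hg.1 (.sum hg.2),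
      ih hg.2]

lemma novConv_constSer_right (f : ℝ → R) (y : S) :
    novConv B f (constSer y) = fun k => B (f k) y := by
  ext k
  rw [novConv, finsum_eq_single _ k fun a ha => by simp [constSer, sub_eq_zero, ha.symm]]
  simp [constSer]

lemma novConv_constSer_left (x : R) (g : ℝ → S) :
    novConv B (constSer x) g = fun k => B x (g k) := by
  ext k
  rw [novConv, finsum_eq_single _ 0 fun a ha => by simp [constSer, ha]]
  simp [constSer]

end Conv

section ConvQ

variable {H : Type*} [AddCommGroup H] [Module ℚ H]

lemma convQ_eq_novConv (f : ℝ → ℚ) (α : ℝ → H) : convQ f α = novConv (smulAddHom ℚ H) f α := rfl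

lemma NovCondG.convQ {f : ℝ → ℚ} {α : ℝ → H} (hf : NovCondG f) (hα : NovCondG α) :
    NovCondG (convQ f α) := hf.novConv (smulAddHom ℚ H) hα

lemma VanishesBelow.convQ {f : ℝ → ℚ} {α : ℝ → H} {c d : ℝ} (hf : VanishesBelow c f)
    (hα : VanishesBelow d α) : VanishesBelow (c + d) (convQ f α) :=
  hf.novConv (smulAddHom ℚ H) hα

lemma convQ_constSer (f : ℝ → ℚ) (y : H) : convQ f (constSer y) = fun k => f k • y :=
  novConv_constSer_right (smulAddHom ℚ H) f y

lemma constSer_one_convQ (α : ℝ → H) : convQ (constSer 1) α = α := by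
  rw [convQ_eq_novConv, novConv_constSer_left]
  simp

lemma convQ_convQ {f g : ℝ → ℚ} {α : ℝ → H} (hf : NovCondG f) (hg : NovCondG g)
    (hα : NovCondG α) : convQ f (convQ g α) = convQ (convQ f g) α := by
  obtain ⟨c, hc⟩ := hg.exists_vanishesBelow
  obtain ⟨d, hd⟩ := hα.exists_vanishesBelow
  ext k
  set F := (hf (k - d - c + 1)).toFinset with hF
  have hmem : ∀ a, f a ≠ 0 → a ∉ F → k - d - c + 1 ≤ a := fun a ha haF => by
    by_contra! h
    exact haF (by simp [hF, h, ha])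
  have hR : ∀ e, convQ f g e • α (k - e) = ∑ a ∈ F, f a • g (e - a) • α (k - e) := by
    intro e
    by_cases h0 : α (k - e) = 0
    · simp [h0]
    have he : d ≤ k - e := not_lt.1 fun h => h0 (hd _ h)
    have : convQ f g e = ∑ a ∈ F, f a • g (e - a) := by
      refine finsum_eq_sum_of_support_subset _ fun a ha => ?_
      by_contra haF
      have := hmem a (fun h => ha (by simp [h])) haF
      exact ha (by simp [hc (e - a) (by linarith)])
    rw [this, Finset.sum_smul]
    simp only [smul_assoc]
  have hfin : ∀ a, (Function.support fun e => g (e - a) • α (k - e)).Finite := fun a => by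
    refine ((novConv_finite_support (smulAddHom ℚ H) hg hα (k - a)).image (· + a)).subset ?_
    intro e he
    refine ⟨e - a, ?_, by simp⟩
    simpa using he
  have hL : convQ f (convQ g α) k = ∑ a ∈ F, f a • convQ g α (k - a) := by
    refine finsum_eq_sum_of_support_subset _ fun a ha => ?_
    by_contra haF
    have := hmem a (fun h => ha (by simp [h])) haF
    exact ha (by simp [hc.convQ hd (k - a) (by linarith)])
  rw [hL]
  change _ = ∑ᶠ e, convQ f g e • α (k - e)
  rw [finsum_congr hR, finsum_sum_comm]
  · refine Finset.sum_congr rfl fun a _ => ?_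
    rw [← smul_finsum' _ (hfin a)]
    congr 1
    rw [← finsum_comp_equiv (Equiv.addRight a)]
    refine finsum_congr fun b => ?_
    simp [sub_sub, add_comm]
  · exact fun a _ => (hfin a).subset (Function.support_const_smul_subset _ _)

end ConvQ

/-! ### Deformed products -/

namespace IsDeltaDeformation

variable {H : Type*} [CommRing H] [Algebra ℚ H] {δ : ℝ} {st : (ℝ → H) → (ℝ → H) → (ℝ → H)}

section

variable {α β γ ε : ℝ → H}

lemma novCondG (hst : IsDeltaDeformation δ st)
    (hα : NovCondG α) (hβ : NovCondG β) : NovCondG (st α β) := hst.1 α β hα hβ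

lemma comm (hst : IsDeltaDeformation δ st)
    (hα : NovCondG α) (hβ : NovCondG β) : st α β = st β α := hst.2.1 α β hα hβ

lemma assoc (hst : IsDeltaDeformation δ st) (hα : NovCondG α) (hβ : NovCondG β) (hγ : NovCondG γ) :
    st (st α β) γ = st α (st β γ) := hst.2.2.1 α β γ hα hβ hγ

lemma add_left (hst : IsDeltaDeformation δ st)
    (hα : NovCondG α) (hβ : NovCondG β) (hγ : NovCondG γ) :
    st (α + β) γ = st α γ + st β γ := hst.2.2.2.1 α β γ hα hβ hγ

lemma convQ_left (hst : IsDeltaDeformation δ st)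
    {f : ℝ → ℚ} (hf : NovCondG f) (hα : NovCondG α) (hβ : NovCondG β) :
    st (convQ f α) β = convQ f (st α β) := hst.2.2.2.2.1 f α β hf hα hβ

lemma one_left (hst : IsDeltaDeformation δ st)
    (hα : NovCondG α) : st (constSer 1) α = α := hst.2.2.2.2.2.1 α hα

lemma zero_left (hst : IsDeltaDeformation δ st) (hα : NovCondG α) : st 0 α = 0 := by
  simpa using hst.add_left NovCondG.zero NovCondG.zero hα

lemma zero_right (hst : IsDeltaDeformation δ st) (hα : NovCondG α) : st α 0 = 0 := by
  rw [hst.comm hα .zero, hst.zero_left hα]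

lemma sub_left (hst : IsDeltaDeformation δ st)
    (hα : NovCondG α) (hβ : NovCondG β) (hγ : NovCondG γ) :
    st (α - β) γ = st α γ - st β γ := by
  rw [eq_sub_iff_add_eq, ← hst.add_left (hα.sub hβ) hβ hγ, sub_add_cancel]

lemma sub_right (hst : IsDeltaDeformation δ st)
    (hα : NovCondG α) (hβ : NovCondG β) (hγ : NovCondG γ) :
    st α (β - γ) = st α β - st α γ := by
  rw [hst.comm hα (hβ.sub hγ), hst.sub_left hβ hγ hα, hst.comm hβ hα, hst.comm hγ hα]

lemma convQ_right (hst : IsDeltaDeformation δ st)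
    {f : ℝ → ℚ} (hf : NovCondG f) (hα : NovCondG α) (hβ : NovCondG β) :
    st α (convQ f β) = convQ f (st α β) := by
  rw [hst.comm hα (hf.convQ hβ), hst.convQ_left hf hβ hα, hst.comm hβ hα]

lemma sum_left (hst : IsDeltaDeformation δ st)
    {ι : Type*} (s : Finset ι) {f : ι → ℝ → H} (hf : ∀ i ∈ s, NovCondG (f i))
    (hα : NovCondG α) : st (∑ i ∈ s, f i) α = ∑ i ∈ s, st (f i) α := by
  classical
  induction s using Finset.induction_on with
  | empty => simpa using hst.zero_left hα
  | insert i s hi ih =>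
    simp only [Finset.forall_mem_insert] at hf
    rw [Finset.sum_insert hi, Finset.sum_insert hi, hst.add_left hf.1 (.sum hf.2) hα, ih hf.2]

lemma sum_right (hst : IsDeltaDeformation δ st)
    {ι : Type*} (s : Finset ι) {f : ι → ℝ → H} (hf : ∀ i ∈ s, NovCondG (f i))
    (hα : NovCondG α) : st α (∑ i ∈ s, f i) = ∑ i ∈ s, st α (f i) := by
  rw [hst.comm hα (.sum hf), hst.sum_left s hf hα]
  exact Finset.sum_congr rfl fun i hi => hst.comm (hf i hi) hα

lemma mul_mul_mul_comm (hst : IsDeltaDeformation δ st)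
    (hα : NovCondG α) (hβ : NovCondG β) (hγ : NovCondG γ) (hε : NovCondG ε) :
    st (st α β) (st γ ε) = st (st α γ) (st β ε) := by
  rw [hst.assoc hα hβ (hst.novCondG hγ hε), ← hst.assoc hβ hγ hε, hst.comm hβ hγ,
    hst.assoc hγ hβ hε, hst.assoc hα hγ (hst.novCondG hβ hε)]

lemma vanishesBelow_constSer_sub (hst : IsDeltaDeformation δ st) (y z : H) :
    VanishesBelow δ (st (constSer y) (constSer z) - constSer (y * z)) := by
  have h0 : (constSer 0 : ℝ → H) = 0 := by ext; simp [constSer]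
  by_cases hy : y = 0
  · rw [hy, zero_mul, h0, hst.zero_left (.constSer z)]
    exact fun _ _ => by simp
  by_cases hz : z = 0
  · rw [hz, mul_zero, h0, hst.zero_right (.constSer y)]
    exact fun _ _ => by simp
  exact ((hst.novCondG (.constSer y) (.constSer z)).sub (.constSer _)).vanishesBelow_of_le
    (hst.2.2.2.2.2.2 y z hy hz)

lemma vanishesBelow (hst : IsDeltaDeformation δ st)
    [FiniteDimensional ℚ H] (hδ : 0 ≤ δ) (hα : NovCondG α) (hβ : NovCondG β)
    {c d : ℝ} (hc : VanishesBelow c α) (hd : VanishesBelow d β) :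
    VanishesBelow (c + d) (st α β) := by
  let e := Module.finBasis ℚ H
  have key : ∀ γ : ℝ → H, γ = ∑ i, convQ (fun k => e.repr (γ k) i) (constSer (e i)) := by
    intro γ
    ext k
    rw [Finset.sum_apply]
    simp only [convQ_constSer]
    exact (e.sum_repr (γ k)).symm
  have hnov : ∀ γ : ℝ → H, NovCondG γ → ∀ i, NovCondG fun k => e.repr (γ k) i :=
    fun γ hγ i => hγ.map (fun h => e.repr h i) (by simp)
  have hvan : ∀ (γ : ℝ → H) (c : ℝ), VanishesBelow c γ → ∀ i,
      VanishesBelow c fun k => e.repr (γ k) i := fun γ c hγ i k hk => by simp [hγ k hk]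
  rw [key α, key β, hst.sum_left _ (fun i _ => (hnov α hα i).convQ (.constSer _))
    (.sum fun i _ => (hnov β hβ i).convQ (.constSer _))]
  refine VanishesBelow.sum fun i _ => ?_
  rw [hst.sum_right _ (fun j _ => (hnov β hβ j).convQ (.constSer _))
    ((hnov α hα i).convQ (.constSer _))]
  refine VanishesBelow.sum fun j _ => ?_
  rw [hst.convQ_left (hnov α hα i) (.constSer _) ((hnov β hβ j).convQ (.constSer _)),
    hst.convQ_right (hnov β hβ j) (.constSer _) (.constSer _)]
  refine (hvan α c hc i).convQ ?_
  rw [← add_zero d]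
  refine (hvan β d hd j).convQ ?_
  rw [← sub_add_cancel (st _ _) (constSer (e i * e j))]
  exact ((hst.vanishesBelow_constSer_sub _ _).mono hδ).add (.constSer _)

lemma novCondG_starPow (hst : IsDeltaDeformation δ st)
    (hα : NovCondG α) (n : ℕ) : NovCondG (starPow st α n) := by
  induction n with
  | zero => exact .constSer 1
  | succ n ih => exact hst.novCondG hα ih

lemma starPow_add (hst : IsDeltaDeformation δ st) (hα : NovCondG α) (m n : ℕ) :
    starPow st α (m + n) = st (starPow st α m) (starPow st α n) := by
  induction m with
  | zero =>
    rw [zero_add]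
    exact (hst.one_left (hst.novCondG_starPow hα n)).symm
  | succ m ih =>
    rw [Nat.add_right_comm]
    simp only [starPow]
    rw [ih, hst.assoc hα (hst.novCondG_starPow hα m) (hst.novCondG_starPow hα n)]

lemma novCondG_foldr (hst : IsDeltaDeformation δ st)
    {ι : Type*} (l : List ι) {f : ι → ℝ → H} (hf : ∀ i, NovCondG (f i)) :
    NovCondG (l.foldr (fun i acc => st (f i) acc) (constSer 1)) := by
  induction l with
  | nil => exact .constSer 1
  | cons i l ih => exact hst.novCondG (hf i) ih

lemma foldr_mul (hst : IsDeltaDeformation δ st)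
    {ι : Type*} (l : List ι) {f g : ι → ℝ → H} (hf : ∀ i, NovCondG (f i))
    (hg : ∀ i, NovCondG (g i)) :
    l.foldr (fun i acc => st (st (f i) (g i)) acc) (constSer 1) =
      st (l.foldr (fun i acc => st (f i) acc) (constSer 1))
        (l.foldr (fun i acc => st (g i) acc) (constSer 1)) := by
  induction l with
  | nil => exact (hst.one_left (.constSer 1)).symm
  | cons i l ih =>
    simp only [List.foldr_cons]
    rw [ih, hst.mul_mul_mul_comm (hf i) (hg i) (hst.novCondG_foldr l hf)
      (hst.novCondG_foldr l hg)]

variable {M : ℕ} (x : Fin M → H)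

lemma novCondG_monEval (hst : IsDeltaDeformation δ st)
    (a : Fin M →₀ ℕ) : NovCondG (monEval st x a) :=
  hst.novCondG_foldr _ fun i => hst.novCondG_starPow (.constSer (x i)) (a i)

lemma monEval_zero (hst : IsDeltaDeformation δ st) : monEval st x 0 = constSer 1 := by
  have : ∀ l : List (Fin M), l.foldr (fun i acc =>
      st (starPow st (constSer (x i)) ((0 : Fin M →₀ ℕ) i)) acc) (constSer 1) = constSer 1 := by
    intro l
    induction l with
    | nil => rfl
    | cons i l ih =>
      rw [List.foldr_cons, ih]
      exact hst.one_left (.constSer 1)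
  exact this _

lemma monEval_add (hst : IsDeltaDeformation δ st) (a b : Fin M →₀ ℕ) :
    monEval st x (a + b) = st (monEval st x a) (monEval st x b) := by
  unfold monEval
  rw [← hst.foldr_mul _ (fun i => hst.novCondG_starPow (.constSer (x i)) (a i))
    (fun i => hst.novCondG_starPow (.constSer (x i)) (b i))]
  simp only [Finsupp.add_apply, hst.starPow_add (.constSer _)]

end

section Approximation

variable [FiniteDimensional ℚ H]

lemma vanishesBelow_mul_sub (hst : IsDeltaDeformation δ st) (hδ : 0 ≤ δ)
    {α β : ℝ → H} {y z : H} (hα : NovCondG α) (hβ : NovCondG β)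
    (hαy : VanishesBelow δ (α - constSer y)) (hβz : VanishesBelow δ (β - constSer z)) :
    VanishesBelow δ (st α β - constSer (y * z)) := by
  have hy : NovCondG (constSer y) := .constSer y
  have hz : NovCondG (constSer z) := .constSer z
  have hβ0 : VanishesBelow 0 β := by
    rw [← sub_add_cancel β (constSer z)]
    exact (hβz.mono hδ).add (.constSer z)
  have h1 := hst.vanishesBelow hδ (hα.sub hy) hβ hαy hβ0
  have h2 := hst.vanishesBelow hδ hy (hβ.sub hz) (.constSer y) hβz
  rw [add_zero, hst.sub_left hα hy hβ] at h1
  rw [zero_add, hst.sub_right hy hβ hz] at h2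
  have := (h1.add h2).add (hst.vanishesBelow_constSer_sub y z)
  rwa [sub_add_sub_cancel, sub_add_sub_cancel] at this

lemma vanishesBelow_starPow_sub (hst : IsDeltaDeformation δ st) (hδ : 0 ≤ δ) (y : H) (n : ℕ) :
    VanishesBelow δ (starPow st (constSer y) n - constSer (y ^ n)) := by
  induction n with
  | zero => simp [starPow, VanishesBelow]
  | succ n ih =>
    rw [pow_succ']
    exact hst.vanishesBelow_mul_sub hδ (.constSer y) (hst.novCondG_starPow (.constSer y) n)
      (fun _ _ => by simp) ih

lemma vanishesBelow_monEval_sub (hst : IsDeltaDeformation δ st) (hδ : 0 ≤ δ)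
    {M : ℕ} (x : Fin M → H) (a : Fin M →₀ ℕ) :
    VanishesBelow δ
      (monEval st x a - constSer (MvPolynomial.aeval x (MvPolynomial.monomial a (1 : ℚ)))) := by
  have hl : ∀ l : List (Fin M), VanishesBelow δ
      (l.foldr (fun i acc => st (starPow st (constSer (x i)) (a i)) acc) (constSer 1) -
        constSer (l.map fun i => x i ^ a i).prod) := by
    intro l
    induction l with
    | nil => simp [VanishesBelow]
    | cons i l ih =>
      rw [List.foldr_cons, List.map_cons, List.prod_cons]
      exact hst.vanishesBelow_mul_sub hδ (hst.novCondG_starPow (.constSer _) _)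
        (hst.novCondG_foldr l fun i => hst.novCondG_starPow (.constSer _) _)
        (hst.vanishesBelow_starPow_sub hδ _ _) ih
  have hprod : MvPolynomial.aeval x (MvPolynomial.monomial a (1 : ℚ)) =
      ((List.finRange M).map fun i => x i ^ a i).prod := by
    rw [MvPolynomial.aeval_monomial, map_one, one_mul,
      Finsupp.prod_fintype _ _ fun i => pow_zero _, ← List.ofFn_eq_map, List.prod_ofFn]
  rw [hprod]
  exact hl _

end Approximation

end IsDeltaDeformation

/-! ### Polynomials with Novikov coefficients -/

section PolyNov

variable {M : ℕ}

lemma IsPolyNov.exists_support {p : ℝ → MvPolynomial (Fin M) ℚ} (hp : IsPolyNov p) :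
    ∃ s : Finset (Fin M →₀ ℕ), ∀ k, (p k).support ⊆ s :=
  ⟨hp.2.toFinset, fun k a ha => by simpa using ⟨k, by simpa using ha⟩⟩

lemma NovCondG.isPolyNov {p : ℝ → MvPolynomial (Fin M) ℚ} (hp : NovCondG p)
    (s : Finset (Fin M →₀ ℕ)) (hs : ∀ k, (p k).support ⊆ s) : IsPolyNov p :=
  ⟨hp, s.finite_toSet.subset (Set.iUnion_subset fun k => Finset.coe_subset.2 (hs k))⟩

lemma NovCondG.isPolyNov_of_finite {p : ℝ → MvPolynomial (Fin M) ℚ} (hp : NovCondG p)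
    (hfin : {k | p k ≠ 0}.Finite) : IsPolyNov p := by
  classical
  refine hp.isPolyNov (hfin.toFinset.biUnion fun k => (p k).support) fun k => ?_
  by_cases h : p k = 0
  · simp [h]
  · exact Finset.subset_biUnion_of_mem (fun k => (p k).support) (by simpa using h)

namespace IsPolyNov

variable {p q : ℝ → MvPolynomial (Fin M) ℚ}

lemma zero : IsPolyNov (0 : ℝ → MvPolynomial (Fin M) ℚ) :=
  NovCondG.zero.isPolyNov ∅ fun k => by simp

lemma add (hp : IsPolyNov p) (hq : IsPolyNov q) : IsPolyNov (p + q) := by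
  classical
  obtain ⟨s, hs⟩ := hp.exists_support
  obtain ⟨t, ht⟩ := hq.exists_support
  exact (hp.1.add hq.1).isPolyNov (s ∪ t) fun k =>
    MvPolynomial.support_add.trans (Finset.union_subset_union (hs k) (ht k))

lemma neg (hp : IsPolyNov p) : IsPolyNov (-p) := by
  obtain ⟨s, hs⟩ := hp.exists_support
  exact hp.1.neg.isPolyNov s fun k => by simpa using hs k

lemma sub (hp : IsPolyNov p) (hq : IsPolyNov q) : IsPolyNov (p - q) :=
  sub_eq_add_neg p q ▸ hp.add hq.neg

lemma sum {ι : Type*} {s : Finset ι} {f : ι → ℝ → MvPolynomial (Fin M) ℚ}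
    (hf : ∀ i ∈ s, IsPolyNov (f i)) : IsPolyNov (∑ i ∈ s, f i) :=
  Finset.sum_induction f IsPolyNov (fun _ _ => add) zero hf

lemma embedPoly (w : MvPolynomial (Fin M) ℚ) : IsPolyNov (embedPoly w) := by
  refine (NovCondG.constSer w).isPolyNov w.support fun k => ?_
  unfold constSer
  split_ifs <;> simp

lemma coeff (hp : IsPolyNov p) (a : Fin M →₀ ℕ) :
    NovCondG fun k => MvPolynomial.coeff a (p k) :=
  hp.1.map (MvPolynomial.coeff a) (MvPolynomial.coeff_zero a)

end IsPolyNov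

lemma NovCondG.isPolyNov_monomial {f : ℝ → ℚ} (hf : NovCondG f) (a : Fin M →₀ ℕ) :
    IsPolyNov fun k => MvPolynomial.monomial a (f k) :=
  (hf.map (MvPolynomial.monomial a) (map_zero _)).isPolyNov {a}
    fun _ => MvPolynomial.support_monomial_subset

lemma polyMul_eq_novConv (p q : ℝ → MvPolynomial (Fin M) ℚ) :
    polyMul p q = novConv AddMonoidHom.mul p q := rfl

lemma IsPolyNov.polyMul {p q : ℝ → MvPolynomial (Fin M) ℚ} (hp : IsPolyNov p)
    (hq : IsPolyNov q) : IsPolyNov (polyMul p q) := by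
  classical
  obtain ⟨s, hs⟩ := hp.exists_support
  obtain ⟨t, ht⟩ := hq.exists_support
  refine (hp.1.novConv AddMonoidHom.mul hq.1).isPolyNov (Finset.image₂ (· + ·) s t) fun k => ?_
  refine finsum_induction (fun P : MvPolynomial (Fin M) ℚ => P.support ⊆ _) (by simp)
    (fun P Q hP hQ => MvPolynomial.support_add.trans (Finset.union_subset hP hQ)) fun a => ?_
  exact (MvPolynomial.support_mul _ _).trans (Finset.image₂_subset (hs a) (ht (k - a)))

lemma polyMul_monomial {f g : ℝ → ℚ} (hf : NovCondG f) (hg : NovCondG g) (a b : Fin M →₀ ℕ) :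
    polyMul (fun k => MvPolynomial.monomial a (f k)) (fun k => MvPolynomial.monomial b (g k)) =
      fun k => MvPolynomial.monomial (a + b) (convQ f g k) := by
  ext1 k
  simp only [polyMul, MvPolynomial.monomial_mul]
  exact ((MvPolynomial.monomial (R := ℚ) (a + b)).toAddMonoidHom.map_finsum
    (novConv_finite_support (smulAddHom ℚ ℚ) hf hg k)).symm

lemma eq_sum_monomial {p : ℝ → MvPolynomial (Fin M) ℚ} {s : Finset (Fin M →₀ ℕ)}
    (hs : ∀ k, (p k).support ⊆ s) :
    p = ∑ a ∈ s, fun k => MvPolynomial.monomial a (MvPolynomial.coeff a (p k)) := by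
  ext1 k
  rw [Finset.sum_apply]
  conv_lhs => rw [(p k).as_sum]
  exact Finset.sum_subset (hs k) fun a _ ha => by
    rw [MvPolynomial.notMem_support_iff.1 ha, map_zero]

end PolyNov

/-! ### The evaluation homomorphism -/

namespace IsDeltaDeformation

variable {H : Type*} [CommRing H] [Algebra ℚ H] {δ : ℝ} {st : (ℝ → H) → (ℝ → H) → (ℝ → H)}
  {M : ℕ} (x : Fin M → H)

lemma polyEval_eq_sum (hst : IsDeltaDeformation δ st)
    {p : ℝ → MvPolynomial (Fin M) ℚ} (hp : IsPolyNov p)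
    {s : Finset (Fin M →₀ ℕ)} (hs : ∀ k, (p k).support ⊆ s) :
    polyEval st x p =
      ∑ a ∈ s, convQ (fun k => MvPolynomial.coeff a (p k)) (monEval st x a) := by
  ext k
  rw [Finset.sum_apply]
  change ∑ᶠ b : ℝ, _ = ∑ a ∈ s, ∑ᶠ b : ℝ, _
  refine Eq.trans ?_ (finsum_sum_comm _ _ fun a _ => novConv_finite_support (smulAddHom ℚ H)
    (hp.coeff a) (hst.novCondG_monEval x a) k)
  refine finsum_congr fun b => Finset.sum_subset (hs b) fun a _ ha => ?_
  rw [MvPolynomial.notMem_support_iff.1 ha, zero_smul]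

lemma novCondG_polyEval (hst : IsDeltaDeformation δ st)
    {p : ℝ → MvPolynomial (Fin M) ℚ} (hp : IsPolyNov p) :
    NovCondG (polyEval st x p) := by
  obtain ⟨s, hs⟩ := hp.exists_support
  rw [hst.polyEval_eq_sum x hp hs]
  exact NovCondG.sum fun a _ => (hp.coeff a).convQ (hst.novCondG_monEval x a)

lemma polyEval_monomial (hst : IsDeltaDeformation δ st)
    {f : ℝ → ℚ} (hf : NovCondG f) (a : Fin M →₀ ℕ) :
    polyEval st x (fun k => MvPolynomial.monomial a (f k)) = convQ f (monEval st x a) := by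
  rw [hst.polyEval_eq_sum x (hf.isPolyNov_monomial a) (s := {a})
    fun _ => MvPolynomial.support_monomial_subset]
  simp

lemma polyEval_add (hst : IsDeltaDeformation δ st)
    {p q : ℝ → MvPolynomial (Fin M) ℚ} (hp : IsPolyNov p) (hq : IsPolyNov q) :
    polyEval st x (p + q) = polyEval st x p + polyEval st x q := by
  classical
  obtain ⟨s, hs⟩ := hp.exists_support
  obtain ⟨t, ht⟩ := hq.exists_support
  have hs' : ∀ k, (p k).support ⊆ s ∪ t := fun k => (hs k).trans Finset.subset_union_left
  have ht' : ∀ k, (q k).support ⊆ s ∪ t := fun k => (ht k).trans Finset.subset_union_right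
  rw [hst.polyEval_eq_sum x hp hs', hst.polyEval_eq_sum x hq ht',
    hst.polyEval_eq_sum x (hp.add hq)
      fun k => MvPolynomial.support_add.trans (Finset.union_subset (hs' k) (ht' k)),
    ← Finset.sum_add_distrib]
  refine Finset.sum_congr rfl fun a _ => ?_
  rw [convQ_eq_novConv, convQ_eq_novConv, convQ_eq_novConv,
    ← novConv_add_left _ (hp.coeff a) (hq.coeff a) (hst.novCondG_monEval x a)]
  congr 1

lemma polyEval_zero (hst : IsDeltaDeformation δ st) : polyEval st x 0 = 0 := by
  simpa using hst.polyEval_add x IsPolyNov.zero IsPolyNov.zero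

lemma polyEval_sub (hst : IsDeltaDeformation δ st)
    {p q : ℝ → MvPolynomial (Fin M) ℚ} (hp : IsPolyNov p) (hq : IsPolyNov q) :
    polyEval st x (p - q) = polyEval st x p - polyEval st x q := by
  rw [eq_sub_iff_add_eq, ← hst.polyEval_add x (hp.sub hq) hq, sub_add_cancel]

lemma polyEval_sum (hst : IsDeltaDeformation δ st)
    {ι : Type*} (s : Finset ι) {f : ι → ℝ → MvPolynomial (Fin M) ℚ}
    (hf : ∀ i ∈ s, IsPolyNov (f i)) :
    polyEval st x (∑ i ∈ s, f i) = ∑ i ∈ s, polyEval st x (f i) := by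
  classical
  induction s using Finset.induction_on with
  | empty => simpa using hst.polyEval_zero x
  | insert i s hi ih =>
    simp only [Finset.forall_mem_insert] at hf
    rw [Finset.sum_insert hi, Finset.sum_insert hi,
      hst.polyEval_add x hf.1 (IsPolyNov.sum hf.2), ih hf.2]

lemma polyEval_mul (hst : IsDeltaDeformation δ st)
    {p q : ℝ → MvPolynomial (Fin M) ℚ} (hp : IsPolyNov p) (hq : IsPolyNov q) :
    polyEval st x (polyMul p q) = st (polyEval st x p) (polyEval st x q) := by
  obtain ⟨s, hs⟩ := hp.exists_support
  obtain ⟨t, ht⟩ := hq.exists_support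
  have hP := fun a => (hp.coeff a).isPolyNov_monomial a
  have hQ := fun a => (hq.coeff a).isPolyNov_monomial a
  have hev : ∀ {r : ℝ → MvPolynomial (Fin M) ℚ} (_ : IsPolyNov r) (a : Fin M →₀ ℕ),
      NovCondG (convQ (fun k => MvPolynomial.coeff a (r k)) (monEval st x a)) :=
    fun hr a => (hr.coeff a).convQ (hst.novCondG_monEval x a)
  have hmul : polyMul p q = ∑ a ∈ s, ∑ b ∈ t,
      polyMul (fun k => MvPolynomial.monomial a (MvPolynomial.coeff a (p k)))
        (fun k => MvPolynomial.monomial b (MvPolynomial.coeff b (q k))) := by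
    conv_lhs => rw [eq_sum_monomial hs, eq_sum_monomial ht]
    rw [polyMul_eq_novConv, novConv_sum_left _ _ (fun a _ => (hP a).1)
      (NovCondG.sum fun b _ => (hQ b).1)]
    exact Finset.sum_congr rfl fun a _ => novConv_sum_right _ _ (hP a).1 fun b _ => (hQ b).1
  rw [hmul, hst.polyEval_sum x s fun a _ => IsPolyNov.sum fun b _ => (hP a).polyMul (hQ b),
    hst.polyEval_eq_sum x hp hs, hst.polyEval_eq_sum x hq ht,
    hst.sum_left s (fun a _ => hev hp a) (.sum fun b _ => hev hq b)]
  refine Finset.sum_congr rfl fun a _ => ?_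
  rw [hst.polyEval_sum x t fun b _ => (hP a).polyMul (hQ b),
    hst.sum_right t (fun b _ => hev hq b) (hev hp a)]
  refine Finset.sum_congr rfl fun b _ => ?_
  have ha := hst.novCondG_monEval x a
  have hb := hst.novCondG_monEval x b
  rw [polyMul_monomial (hp.coeff a) (hq.coeff b),
    hst.polyEval_monomial x ((hp.coeff a).convQ (hq.coeff b)),
    hst.convQ_left (hp.coeff a) ha (hev hq b), hst.convQ_right (hq.coeff b) ha hb,
    ← hst.monEval_add,
    convQ_convQ (hp.coeff a) (hq.coeff b) (hst.novCondG_monEval x (a + b))]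

lemma polyEval_one (hst : IsDeltaDeformation δ st) : polyEval st x (embedPoly 1) = constSer 1 := by
  have h : (embedPoly 1 : ℝ → MvPolynomial (Fin M) ℚ) =
      fun k => MvPolynomial.monomial 0 (constSer (1 : ℚ) k) := by
    ext1 k
    unfold embedPoly constSer
    split_ifs <;> simp
  rw [h, hst.polyEval_monomial x (.constSer 1), constSer_one_convQ, hst.monEval_zero]

/-- Modulo terms of valuation `δ` higher, deformed evaluation is coefficientwise evaluation. -/
lemma vanishesBelow_polyEval_sub (hst : IsDeltaDeformation δ st)
    [FiniteDimensional ℚ H] (hδ : 0 ≤ δ)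
    {p : ℝ → MvPolynomial (Fin M) ℚ} (hp : IsPolyNov p) {c : ℝ} (hc : VanishesBelow c p) :
    VanishesBelow (c + δ) (polyEval st x p - fun k => MvPolynomial.aeval x (p k)) := by
  obtain ⟨s, hs⟩ := hp.exists_support
  have h : (fun k => MvPolynomial.aeval x (p k)) = ∑ a ∈ s,
      convQ (fun k => MvPolynomial.coeff a (p k))
        (constSer (MvPolynomial.aeval x (MvPolynomial.monomial a (1 : ℚ)))) := by
    ext k
    rw [Finset.sum_apply]
    conv_lhs => rw [eq_sum_monomial hs, Finset.sum_apply, map_sum]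
    refine Finset.sum_congr rfl fun a _ => ?_
    simp only [convQ_constSer]
    rw [← map_smul, MvPolynomial.smul_monomial, smul_eq_mul, mul_one]
  rw [h, hst.polyEval_eq_sum x hp hs, ← Finset.sum_sub_distrib]
  refine VanishesBelow.sum fun a _ => ?_
  rw [convQ_eq_novConv, convQ_eq_novConv,
    ← novConv_sub_right _ (hp.coeff a) (hst.novCondG_monEval x a) (.constSer _)]
  refine VanishesBelow.novConv _ (fun k hk => ?_) (hst.vanishesBelow_monEval_sub hδ x a)
  rw [hc k hk, MvPolynomial.coeff_zero]

lemma vanishesBelow_polyEval (hst : IsDeltaDeformation δ st) [FiniteDimensional ℚ H] (hδ : 0 ≤ δ)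
    {p : ℝ → MvPolynomial (Fin M) ℚ} (hp : IsPolyNov p) {c : ℝ} (hc : VanishesBelow c p) :
    VanishesBelow c (polyEval st x p) := by
  rw [← sub_add_cancel (polyEval st x p) fun k => MvPolynomial.aeval x (p k)]
  refine ((hst.vanishesBelow_polyEval_sub x hδ hp hc).mono (by linarith)).add fun k hk => ?_
  rw [hc k hk, map_zero]

end IsDeltaDeformation

/-! ### Surjectivity and the kernel of evaluation -/

lemma exists_nat_le_add_mul {δ : ℝ} (hδ : 0 < δ) (c d : ℝ) : ∃ n : ℕ, d ≤ c + n * δ := by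
  obtain ⟨n, hn⟩ := exists_nat_ge ((d - c) / δ)
  exact ⟨n, by linarith [(div_le_iff₀ hδ).1 hn]⟩

/-- A series of Novikov series whose valuations grow linearly converges. -/
lemma exists_novCondG_sum {R : Type*} [AddCommGroup R] {δ : ℝ} (hδ : 0 < δ) (c : ℝ)
    {f : ℕ → ℝ → R} (hf : ∀ n, NovCondG (f n)) (hv : ∀ n : ℕ, VanishesBelow (c + n * δ) (f n)) :
    ∃ g : ℝ → R, NovCondG g ∧
      ∀ n : ℕ, VanishesBelow (c + n * δ) (g - ∑ i ∈ Finset.range n, f i) := by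
  have hg : ∀ n : ℕ, ∀ k < c + n * δ, ∑ᶠ i, f i k = ∑ i ∈ Finset.range n, f i k := by
    intro n k hk
    refine finsum_eq_sum_of_support_subset _ fun i hi => ?_
    by_contra h
    have hni : (n : ℝ) ≤ i := by simpa using h
    exact hi (hv i k (by nlinarith))
  refine ⟨fun k => ∑ᶠ i, f i k, fun d => ?_, fun n k hk => ?_⟩
  · obtain ⟨n, hn⟩ := exists_nat_le_add_mul hδ c d
    refine (NovCondG.sum (s := Finset.range n) (fun i _ => hf i) d).subset ?_
    rintro k ⟨hk, h⟩
    refine ⟨hk, ?_⟩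
    rwa [Finset.sum_apply, ← hg n k (hk.trans_le hn)]
  · simp [hg n k hk]

/-- Composing a series with a linear map out of a finite-dimensional space only involves finitely
many monomials. -/
lemma NovCondG.isPolyNov_comp {H : Type*} [AddCommGroup H] [Module ℚ H] [FiniteDimensional ℚ H]
    {M : ℕ} {α : ℝ → H} (hα : NovCondG α) (σ : H →ₗ[ℚ] MvPolynomial (Fin M) ℚ) :
    IsPolyNov fun k => σ (α k) := by
  classical
  let e := Module.finBasis ℚ H
  refine (hα.map σ (map_zero σ)).isPolyNov (Finset.univ.biUnion fun i => (σ (e i)).support)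
    fun k => ?_
  rw [← e.sum_repr (α k), map_sum]
  refine MvPolynomial.support_sum.trans (Finset.biUnion_mono fun i _ => ?_)
  rw [map_smul]
  exact MvPolynomial.support_smul

namespace IsDeltaDeformation

variable {H : Type*} [CommRing H] [Algebra ℚ H] [FiniteDimensional ℚ H] {δ : ℝ}
  {st : (ℝ → H) → (ℝ → H) → (ℝ → H)}
  {M : ℕ} {x : Fin M → H}

lemma polyEval_surjective (hst : IsDeltaDeformation δ st) (hδ : 0 < δ)
    (hgen : Algebra.adjoin ℚ (Set.range x) = ⊤) {α : ℝ → H}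
    (hα : NovCondG α) : ∃ p, IsPolyNov p ∧ polyEval st x p = α := by
  have hsurj : Function.Surjective (MvPolynomial.aeval x : MvPolynomial (Fin M) ℚ →ₐ[ℚ] H) := by
    rwa [← AlgHom.range_eq_top, ← Algebra.adjoin_range_eq_range_aeval]
  obtain ⟨σ, hσ⟩ := (MvPolynomial.aeval x : MvPolynomial (Fin M) ℚ →ₐ[ℚ] H).toLinearMap
    |>.exists_rightInverse_of_surjective (LinearMap.range_eq_top.2 hsurj)
  have hσ' : ∀ h, MvPolynomial.aeval x (σ h) = h := fun h => LinearMap.congr_fun hσ h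
  obtain ⟨c, hc⟩ := hα.exists_vanishesBelow
  -- the remainders of the successive approximations of `α`
  let r : ℕ → ℝ → H := fun n => (fun β => β - polyEval st x fun k => σ (β k))^[n] α
  have hr : ∀ n, r (n + 1) = r n - polyEval st x fun k => σ (r n k) := fun n =>
    Function.iterate_succ_apply' _ n α
  have hrn : ∀ n, NovCondG (r n) := by
    intro n
    induction n with
    | zero => exact hα
    | succ n ih => exact hr n ▸ ih.sub (hst.novCondG_polyEval x (ih.isPolyNov_comp σ))
  have hstep : ∀ (β : ℝ → H) (d : ℝ), NovCondG β → VanishesBelow d β →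
      VanishesBelow (d + δ) ((polyEval st x fun k => σ (β k)) - β) := by
    intro β d hβ hd
    have := hst.vanishesBelow_polyEval_sub x hδ.le (hβ.isPolyNov_comp σ)
      (hd.map σ (map_zero σ))
    simpa only [hσ'] using this
  have hrv : ∀ n : ℕ, VanishesBelow (c + n * δ) (r n) := by
    intro n
    induction n with
    | zero => simpa [r] using hc
    | succ n ih =>
      intro k hk
      have := hstep _ _ (hrn n) ih k (by push_cast at hk; linarith)
      rw [hr n, ← neg_sub, Pi.neg_apply, this, neg_zero]
  obtain ⟨s, hs, hsv⟩ := exists_novCondG_sum hδ c hrn hrv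
  have hpart : ∀ n, (polyEval st x fun k => σ ((∑ i ∈ Finset.range n, r i) k)) = α - r n := by
    intro n
    have : (fun k => σ ((∑ i ∈ Finset.range n, r i) k)) =
        ∑ i ∈ Finset.range n, fun k => σ (r i k) := by
      ext1 k
      simp
    rw [this, hst.polyEval_sum x _ fun i _ => (hrn i).isPolyNov_comp σ]
    have : ∀ i, (polyEval st x fun k => σ (r i k)) = r i - r (i + 1) := fun i => by
      rw [hr i, sub_sub_cancel]
    simp only [this]
    exact Finset.sum_range_sub' r n
  refine ⟨_, hs.isPolyNov_comp σ, sub_eq_zero.1 (VanishesBelow.eq_zero fun d => ?_)⟩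
  obtain ⟨n, hn⟩ := exists_nat_le_add_mul hδ c d
  have hsum : NovCondG (∑ i ∈ Finset.range n, r i) := .sum fun i _ => hrn i
  have h1 := hst.vanishesBelow_polyEval x hδ.le ((hs.sub hsum).isPolyNov_comp σ)
    ((hsv n).map σ (map_zero σ))
  have h2 : (fun k => σ ((s - ∑ i ∈ Finset.range n, r i) k)) =
      (fun k => σ (s k)) - fun k => σ ((∑ i ∈ Finset.range n, r i) k) := by
    ext1 k
    simp
  rw [h2, hst.polyEval_sub x (hs.isPolyNov_comp σ) (hsum.isPolyNov_comp σ), hpart n] at h1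
  have h3 := (h1.sub (hrv n)).mono hn
  rwa [sub_sub, sub_add_cancel] at h3

end IsDeltaDeformation

section Ideal

variable {M m : ℕ} {v : Fin m → ℝ → MvPolynomial (Fin M) ℚ} {p q : ℝ → MvPolynomial (Fin M) ℚ}

lemma InIdealGen.isPolyNov (hv : ∀ i, IsPolyNov (v i)) (hp : InIdealGen v p) : IsPolyNov p := by
  obtain ⟨q, hq, rfl⟩ := hp
  exact .sum fun i _ => (hq i).polyMul (hv i)

lemma InIdealGen.zero : InIdealGen v 0 :=
  ⟨0, fun _ => .zero, by simp [polyMul_eq_novConv]⟩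

lemma InIdealGen.add (hv : ∀ i, IsPolyNov (v i)) (hp : InIdealGen v p) (hq : InIdealGen v q) :
    InIdealGen v (p + q) := by
  obtain ⟨a, ha, rfl⟩ := hp
  obtain ⟨b, hb, rfl⟩ := hq
  refine ⟨fun i => a i + b i, fun i => (ha i).add (hb i), ?_⟩
  simp only [polyMul_eq_novConv, novConv_add_left AddMonoidHom.mul (ha _).1 (hb _).1 (hv _).1,
    Finset.sum_add_distrib]

variable {H : Type*} [CommRing H] [Algebra ℚ H] {δ : ℝ} {st : (ℝ → H) → (ℝ → H) → (ℝ → H)}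
  {x : Fin M → H}

lemma InIdealGen.polyEval_eq_zero (hst : IsDeltaDeformation δ st) (hv : ∀ i, IsPolyNov (v i))
    (hker : ∀ i, polyEval st x (v i) = 0) (hp : InIdealGen v p) : polyEval st x p = 0 := by
  obtain ⟨q, hq, rfl⟩ := hp
  rw [hst.polyEval_sum x _ fun i _ => (hq i).polyMul (hv i)]
  refine Finset.sum_eq_zero fun i _ => ?_
  rw [hst.polyEval_mul x (hq i) (hv i), hker i,
    hst.zero_right (hst.novCondG_polyEval x (hq i))]

variable [FiniteDimensional ℚ H]

lemma CloMem.polyEval_eq_zero (hst : IsDeltaDeformation δ st) (hδ : 0 ≤ δ)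
    (hv : ∀ i, IsPolyNov (v i)) (hker : ∀ i, polyEval st x (v i) = 0) (hp : IsPolyNov p)
    (h : CloMem v p) : polyEval st x p = 0 := by
  refine VanishesBelow.eq_zero fun c => ?_
  obtain ⟨j, hj, hpj⟩ := h c
  have hj0 := hj.polyEval_eq_zero hst hv hker
  rcases hpj with rfl | hpj
  · exact fun k _ => by rw [hj0, Pi.zero_apply]
  · have hsub := hp.sub (hj.isPolyNov hv)
    have := hst.vanishesBelow_polyEval x hδ hsub (hsub.1.vanishesBelow_of_le hpj)
    rwa [hst.polyEval_sub x hp (hj.isPolyNov hv), hj0, sub_zero] at this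

/-- Subtracting a suitable element of the ideal raises the valuation of an element of the kernel
by a fixed amount `ε`. -/
lemma exists_inIdealGen_sub_vanishesBelow (hst : IsDeltaDeformation δ st) (hδ : 0 ≤ δ)
    {w : Fin m → MvPolynomial (Fin M) ℚ}
    (hw : ∀ P : MvPolynomial (Fin M) ℚ,
      MvPolynomial.aeval x P = 0 → P ∈ Ideal.span (Set.range w))
    (hv : ∀ i, IsPolyNov (v i)) {ε : ℝ} (hεδ : ε ≤ δ)
    (hwv : ∀ i, VanishesBelow ε (embedPoly (w i) - v i)) (hp : IsPolyNov p)
    (hker : polyEval st x p = 0) {c : ℝ} (hc : VanishesBelow c p) :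
    ∃ j, InIdealGen v j ∧ VanishesBelow (c + ε) (p - j) := by
  have hspan : ∀ k, k < c + ε → ∃ r : Fin m → MvPolynomial (Fin M) ℚ,
      ∑ i, r i * w i = p k := by
    intro k hk
    rw [← Ideal.mem_span_range_iff_exists_fun]
    apply hw
    have := hst.vanishesBelow_polyEval_sub x hδ hp hc k (by linarith)
    simpa [hker] using this
  choose! r hr using hspan
  classical
  let q : Fin m → ℝ → MvPolynomial (Fin M) ℚ := fun i k =>
    if k < c + ε ∧ p k ≠ 0 then r k i else 0
  have hqfin : ∀ i, {k | q i k ≠ 0}.Finite := fun i =>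
    (hp.1 (c + ε)).subset fun k hk => by
      by_contra h
      exact hk (if_neg h)
  have hq : ∀ i, IsPolyNov (q i) := fun i =>
    NovCondG.isPolyNov_of_finite (fun d => (hqfin i).subset fun k hk => hk.2) (hqfin i)
  have hqc : ∀ i, VanishesBelow c (q i) := fun i k hk =>
    if_neg fun h => h.2 (hc k hk)
  refine ⟨_, ⟨q, hq, rfl⟩, ?_⟩
  have hsplit : p - ∑ i, polyMul (q i) (v i) =
      (p - ∑ i, polyMul (q i) (embedPoly (w i))) +
        ∑ i, polyMul (q i) (embedPoly (w i) - v i) := by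
    have : ∀ i, polyMul (q i) (embedPoly (w i) - v i) =
        polyMul (q i) (embedPoly (w i)) - polyMul (q i) (v i) := fun i => by
      simp only [polyMul_eq_novConv]
      exact novConv_sub_right _ (hq i).1 (IsPolyNov.embedPoly (w i)).1 (hv i).1
    simp only [this, Finset.sum_sub_distrib]
    abel
  rw [hsplit]
  refine VanishesBelow.add (fun k hk => ?_)
    (VanishesBelow.sum fun i _ => polyMul_eq_novConv (q i) _ ▸ (hqc i).novConv _ (hwv i))
  have hmul : ∀ i, polyMul (q i) (embedPoly (w i)) = fun k => q i k * w i := fun i => by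
    rw [polyMul_eq_novConv]
    exact novConv_constSer_right _ (q i) (w i)
  rw [Pi.sub_apply, Finset.sum_apply, sub_eq_zero]
  simp only [hmul]
  by_cases h : p k = 0
  · simp [q, h]
  · simp [q, h, hk, hr k hk]

lemma cloMem_of_polyEval_eq_zero (hst : IsDeltaDeformation δ st) (hδ : 0 < δ)
    {w : Fin m → MvPolynomial (Fin M) ℚ}
    (hw : ∀ P : MvPolynomial (Fin M) ℚ,
      MvPolynomial.aeval x P = 0 → P ∈ Ideal.span (Set.range w))
    (hv : ∀ i, IsPolyNov (v i)) (hker : ∀ i, polyEval st x (v i) = 0)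
    (hwv : ∀ i, 0 < novValE (embedPoly (w i) - v i)) (hp : IsPolyNov p)
    (hp0 : polyEval st x p = 0) : CloMem v p := by
  obtain ⟨ε, hε, hεδ, hεv⟩ : ∃ ε, 0 < ε ∧ ε ≤ δ ∧
      ∀ i, VanishesBelow ε (embedPoly (w i) - v i) := by
    have hev : ∀ i, ∀ᶠ ε in 𝓝[>] (0 : ℝ), VanishesBelow ε (embedPoly (w i) - v i) := by
      intro i
      obtain ⟨η, hη, h⟩ := ((IsPolyNov.embedPoly (w i)).sub (hv i)).1.exists_pos_vanishesBelow
        (hwv i)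
      filter_upwards [Ioo_mem_nhdsGT hη] with ε hε using h.mono hε.2.le
    obtain ⟨ε, h1, h2⟩ := ((eventually_all.2 hev).and (Ioo_mem_nhdsGT hδ)).exists
    exact ⟨ε, h2.1, h2.2.le, h1⟩
  obtain ⟨c, hc⟩ := hp.1.exists_vanishesBelow
  have key : ∀ n : ℕ, ∃ j, InIdealGen v j ∧ VanishesBelow (c + n * ε) (p - j) := by
    intro n
    induction n with
    | zero => exact ⟨0, .zero, by simpa using hc⟩
    | succ n ih =>
      obtain ⟨j, hj, hjv⟩ := ih
      have hjp := hj.isPolyNov hv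
      obtain ⟨j', hj', hjv'⟩ := exists_inIdealGen_sub_vanishesBelow hst hδ.le hw hv hεδ hεv
        (hp.sub hjp)
        (by rw [hst.polyEval_sub x hp hjp, hp0, hj.polyEval_eq_zero hst hv hker, sub_zero]) hjv
      refine ⟨j + j', hj.add hv hj', ?_⟩
      rw [← sub_sub]
      exact hjv'.mono (by push_cast; linarith)
  intro d
  obtain ⟨n, hn⟩ := exists_nat_le_add_mul hε c d
  obtain ⟨j, hj, hjv⟩ := key n
  exact ⟨j, hj, Or.inr (hjv.mono hn).le_novValE⟩

end Ideal

/-- Algebraic skeleton of Theorem 4.7(3).  Under the hypotheses of the kernel lemma,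
the evaluation map `Φ̂ : Λ^univ[X_1,…,X_M] → (A, ∗)`, `X_i ↦ x i`, is a homomorphism
of `Λ^univ`-algebras which is surjective and has kernel exactly
`Clos_{𝔳_T}(⟨v 1, …, v m⟩)`; hence it induces an isomorphism of `Λ^univ`-algebras
`Λ^univ[X_1,…,X_M] / Clos_{𝔳_T}(⟨v 1, …, v m⟩) ≅ (A, ∗)`. -/
theorem deformed_evaluation_induces_isomorphism
    {H : Type*} [CommRing H] [Algebra ℚ H] [FiniteDimensional ℚ H]
    {M m : ℕ} (δ : ℝ) (hδ : 0 < δ)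
    (st : (ℝ → H) → (ℝ → H) → (ℝ → H))
    (hst : IsDeltaDeformation δ st)
    (x : Fin M → H) (hgen : Algebra.adjoin ℚ (Set.range x) = ⊤)
    (w : Fin m → MvPolynomial (Fin M) ℚ)
    (hw : ∀ p : MvPolynomial (Fin M) ℚ,
      MvPolynomial.aeval x p = 0 ↔ p ∈ Ideal.span (Set.range w))
    (v : Fin m → ℝ → MvPolynomial (Fin M) ℚ)
    (hvPoly : ∀ i, IsPolyNov (v i))
    (hvKer : ∀ i, polyEval st x (v i) = 0)
    (hwv : ∀ i, 0 < novValE (embedPoly (w i) - v i)) :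
    -- Φ̂ is additive …
    (∀ p q : ℝ → MvPolynomial (Fin M) ℚ, IsPolyNov p → IsPolyNov q →
      polyEval st x (p + q) = polyEval st x p + polyEval st x q) ∧
    -- … multiplicative with respect to the deformed product ∗ …
    (∀ p q : ℝ → MvPolynomial (Fin M) ℚ, IsPolyNov p → IsPolyNov q →
      polyEval st x (polyMul p q) = st (polyEval st x p) (polyEval st x q)) ∧
    -- … unital …
    polyEval st x (embedPoly 1) = constSer 1 ∧
    -- … surjective onto A …
    (∀ α : ℝ → H, NovCondG α →
      ∃ p : ℝ → MvPolynomial (Fin M) ℚ, IsPolyNov p ∧ polyEval st x p = α) ∧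
    -- … and its kernel is the closure of the ideal ⟨v 1, …, v m⟩; hence Φ̂ induces an
    -- isomorphism Λ^univ[X_1,…,X_M] / Clos_{𝔳_T}(⟨v⟩) ≅ (A, ∗).
    (∀ p : ℝ → MvPolynomial (Fin M) ℚ, IsPolyNov p →
      (polyEval st x p = 0 ↔ CloMem v p)) := by
  exact ⟨fun _ _ hp hq => hst.polyEval_add x hp hq, fun _ _ hp hq => hst.polyEval_mul x hp hq,
    hst.polyEval_one x, fun _ hα => hst.polyEval_surjective hδ hgen hα, fun _ hp =>
      ⟨cloMem_of_polyEval_eq_zero hst hδ (fun P => (hw P).1) hvPoly hvKer hwv hp,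
        CloMem.polyEval_eq_zero hst hδ.le hvPoly hvKer hp⟩⟩
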